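/- Let l : V → V be differentiable and null for η (η(l x, l x) = 0 for all x), let f : V → ℝ be a differentiable scalar field, and let k : V → V be any differentiable vector field. Consider the Kerr-Schild perturbation h x = f x • (l⁰ x ⊗ l⁰ x), i.e. h x (u, w) = f x · η(l x, u) · η(l x, w). Then there exists a covector field v : V → (V → ℝ) such that for all x, u, w: (L_k h) x (u, w) = η(l x, u) · (v x w) + η(l x, w) · (v x u). In other words, the Lie derivative along k of a Kerr-Schild perturbation built on a null vector field l is a perturbation of the special form l⁰ ⊗ v + v ⊗ l⁰ (the form μ·η + l⁰₍ₐv_b₎ with μ = 0). -/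

import Mathlib

/-- The Lie derivative of a (differentiable) bilinear-form field `T : V → (V → V → ℝ)`
along the vector field `k : V → V`:
`(L_k T) x (u, w) = (fderiv T x (k x)) (u, w) + T x (fderiv k x u, w) + T x (u, fderiv k x w)`. -/
noncomputable def lieBil {V : Type*} [NormedAddCommGroup V] [NormedSpace ℝ V]
    (k : V → V) (T : V → (V →L[ℝ] V →L[ℝ] ℝ)) (x u w : V) : ℝ :=
  fderiv ℝ T x (k x) u w + T x (fderiv ℝ k x u) w + T x u (fderiv ℝ k x w)

set_option maxSynthPendingDepth 3 in
theorem smulRight_diff_aux {V : Type*} [NormedAddCommGroup V] [NormedSpace ℝ V]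
    {f : V → ℝ} {a : V → (V →L[ℝ] ℝ)} {x : V} (hf : DifferentiableAt ℝ f x)
    (ha : DifferentiableAt ℝ a x) :
    DifferentiableAt ℝ (fun y => f y •
      (ContinuousLinearMap.smulRightL ℝ V (V →L[ℝ] ℝ) (a y) (a y))) x := by
  have h2 : DifferentiableAt ℝ (fun y =>
      ContinuousLinearMap.smulRightL ℝ V (V →L[ℝ] ℝ) (a y)) x :=
    (ContinuousLinearMap.smulRightL ℝ V (V →L[ℝ] ℝ)).differentiableAt.comp x ha
  exact hf.smul (h2.clm_apply ha)

/-- Let `l : V → V` be differentiable and null for `η`, `f : V → ℝ` a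
differentiable scalar field, and `k : V → V` any differentiable vector field.  Consider the
Kerr-Schild perturbation `h x = f x • (l⁰ x ⊗ l⁰ x)`, i.e.
`h x (u, w) = f x · η (l x) u · η (l x) w`.  Then there exists a covector field
`v : V → (V → ℝ)` such that for all `x`, `u`, `w`:
`(L_k h) x (u, w) = η (l x) u · (v x w) + η (l x) w · (v x u)`, i.e. the Lie derivative
along `k` of a Kerr-Schild perturbation built on a null vector field `l` is a perturbation
of the special form `l⁰ ⊗ v + v ⊗ l⁰` (the form `μ·η + l⁰₍ₐv_b₎` with `μ = 0`). -/
theorem lie_of_kerr_schild_is_special_form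
    {V : Type*} [NormedAddCommGroup V] [NormedSpace ℝ V] [FiniteDimensional ℝ V]
    (η : V →L[ℝ] V →L[ℝ] ℝ) (hη : ∀ u w : V, η u w = η w u)
    (l : V → V) (hl : Differentiable ℝ l)
    (hnull : ∀ x, η (l x) (l x) = 0)
    (f : V → ℝ) (hf : Differentiable ℝ f)
    (k : V → V) (hk : Differentiable ℝ k)
    (h : V → (V →L[ℝ] V →L[ℝ] ℝ))
    (hh : ∀ x u w, h x u w = f x * (η (l x) u * η (l x) w)) :
    ∃ v : V → (V →L[ℝ] ℝ), ∀ x u w,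
      lieBil k h x u w = η (l x) u * v x w + η (l x) w * v x u := by
  have hη' : ∀ x, HasFDerivAt (fun y => η (l y)) (η.comp (fderiv ℝ l x)) x := fun x =>
    η.hasFDerivAt.comp x (hl x).hasFDerivAt
  have hd : Differentiable ℝ h := by
    have e : h = fun x => f x •
        (ContinuousLinearMap.smulRightL ℝ V (V →L[ℝ] ℝ) (η (l x)) (η (l x))) := by
      funext x
      ext u w
      simp [hh]
    rw [e]
    intro x
    have h1 : DifferentiableAt ℝ (fun y => η (l y)) x := (hη' x).differentiableAt
    exact smulRight_diff_aux (hf x) h1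
  have key : ∀ x z u w, fderiv ℝ h x z u w = fderiv ℝ f x z * (η (l x) u * η (l x) w)
      + f x * (η (fderiv ℝ l x z) u * η (l x) w + η (l x) u * η (fderiv ℝ l x z) w) := by
    intro x z u w
    have a1 := (((hd x).hasFDerivAt.clm_apply (hasFDerivAt_const u x)).clm_apply
      (hasFDerivAt_const w x))
    have b : ∀ u, HasFDerivAt (fun y => η (l y) u) _ x := fun u =>
      (hη' x).clm_apply (hasFDerivAt_const u x)
    have a2 := (hf x).hasFDerivAt.mul ((b u).mul (b w))
    have e : (fun y => h y u w) = (f * ((fun y => η (l y) u) * (fun y => η (l y) w))) := by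
      funext y
      simp [hh]
    rw [e] at a1
    have := congrArg (fun L : V →L[ℝ] ℝ => L z) (a1.unique a2)
    simp at this
    rw [this]
    ring
  refine ⟨fun x => (fderiv ℝ f x (k x) / 2) • η (l x) + f x • (η (fderiv ℝ l x (k x))
    + (η (l x)).comp (fderiv ℝ k x)), fun x u w => ?_⟩
  simp only [lieBil, key, hh, add_apply, smul_apply,
    ContinuousLinearMap.comp_apply, smul_eq_mul]
  ring
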